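/- Fix a positive integer n. Define an antisymmetric flow E on the directed edges of the nearest-neighbor graph of ℤ² as follows: for nonnegative integers a, b with a + b ≤ n − 1, set E((a,b),(a+1,b)) = (a+1)·(1/(a+b+1) − 1/(a+b+2)) and E((a,b),(a,b+1)) = 1/(a+b+2) − a·(1/(a+b+1) − 1/(a+b+2)); set E(w,v) = −E(v,w) for the reversed edges, and E = 0 on every other directed edge. Then the divergence div E(v) := Σ_{w adjacent to v} E(v,w) satisfies: div E(0,0) = 1; div E(a,b) = −1/(n+1) for every pair of nonnegative integers (a,b) with a + b = n; and div E(v) = 0 for every other vertex v ∈ ℤ². -/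

import Mathlib

noncomputable section

/-- The nonzero oriented part of the flow `E^n` on `ℤ²`: it is supported on the
edges going right or up from a point `(a,b)` with `a, b ≥ 0` and `a + b ≤ n - 1`. -/
def Ehalf (n : ℕ) (v w : ℤ × ℤ) : ℝ :=
  if 0 ≤ v.1 ∧ 0 ≤ v.2 ∧ v.1 + v.2 ≤ (n : ℤ) - 1 then
    if w = (v.1 + 1, v.2) then
      ((v.1 : ℝ) + 1) * (1 / ((v.1 : ℝ) + (v.2 : ℝ) + 1) - 1 / ((v.1 : ℝ) + (v.2 : ℝ) + 2))
    else if w = (v.1, v.2 + 1) then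
      1 / ((v.1 : ℝ) + (v.2 : ℝ) + 2) -
        (v.1 : ℝ) * (1 / ((v.1 : ℝ) + (v.2 : ℝ) + 1) - 1 / ((v.1 : ℝ) + (v.2 : ℝ) + 2))
    else 0
  else 0

/-- The antisymmetric flow `E^n` on the directed edges of `ℤ²`. -/
def Eflow (n : ℕ) (v w : ℤ × ℤ) : ℝ := Ehalf n v w - Ehalf n w v

/-- Divergence of the flow `E^n` at a vertex: the sum of `E` over the four
outgoing edges. -/
def divE (n : ℕ) (v : ℤ × ℤ) : ℝ :=
  Eflow n v (v.1 + 1, v.2) + Eflow n v (v.1 - 1, v.2) +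
    Eflow n v (v.1, v.2 + 1) + Eflow n v (v.1, v.2 - 1)

/-- The total flow along the two edges leaving `(a, b)` to the right and up. -/
lemma Ehalf_right_add_up (n : ℕ) (a b : ℤ) :
    Ehalf n (a, b) (a + 1, b) + Ehalf n (a, b) (a, b + 1) =
      if 0 ≤ a ∧ 0 ≤ b ∧ a + b ≤ (n : ℤ) - 1 then 1 / ((a : ℝ) + b + 1) else 0 := by
  by_cases h : 0 ≤ a ∧ 0 ≤ b ∧ a + b ≤ (n : ℤ) - 1
  · simp [Ehalf, h]
    ring
  · simp only [Ehalf, if_neg h, add_zero]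

/-- The total flow along the two edges entering `(a, b)` from the left and from below. -/
lemma Ehalf_from_left_add_from_below (n : ℕ) (a b : ℤ) :
    Ehalf n (a - 1, b) (a, b) + Ehalf n (a, b - 1) (a, b) =
      if 0 ≤ a ∧ 0 ≤ b ∧ 1 ≤ a + b ∧ a + b ≤ (n : ℤ) then 1 / ((a : ℝ) + b + 1) else 0 := by
  have e₁ : (a : ℝ) - 1 + b + 1 = a + b := by ring
  have e₂ : (a : ℝ) - 1 + b + 2 = a + b + 1 := by ring
  have e₃ : (a : ℝ) + (b - 1) + 1 = a + b := by ring
  have e₄ : (a : ℝ) + (b - 1) + 2 = a + b + 1 := by ring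
  have left : Ehalf n (a - 1, b) (a, b) =
      if 1 ≤ a ∧ 0 ≤ b ∧ a + b ≤ (n : ℤ) then
        (a : ℝ) * (1 / ((a : ℝ) + b) - 1 / ((a : ℝ) + b + 1)) else 0 := by
    have hiff : (0 ≤ a - 1 ∧ 0 ≤ b ∧ a - 1 + b ≤ (n : ℤ) - 1) ↔
        (1 ≤ a ∧ 0 ≤ b ∧ a + b ≤ (n : ℤ)) := by omega
    simp only [Ehalf, hiff]
    simp [e₁, e₂]
  have below : Ehalf n (a, b - 1) (a, b) =
      if 0 ≤ a ∧ 1 ≤ b ∧ a + b ≤ (n : ℤ) then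
        1 / ((a : ℝ) + b + 1) - (a : ℝ) * (1 / ((a : ℝ) + b) - 1 / ((a : ℝ) + b + 1))
      else 0 := by
    have hiff : (0 ≤ a ∧ 0 ≤ b - 1 ∧ a + (b - 1) ≤ (n : ℤ) - 1) ↔
        (0 ≤ a ∧ 1 ≤ b ∧ a + b ≤ (n : ℤ)) := by omega
    simp only [Ehalf, hiff]
    simp [e₃, e₄]
  rw [left, below]
  by_cases h : 0 ≤ a ∧ 0 ≤ b ∧ 1 ≤ a + b ∧ a + b ≤ (n : ℤ)
  · rw [if_pos h]
    obtain ⟨ha, hb, hab, habn⟩ := h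
    rcases hb.eq_or_lt with rfl | hb
    · have ha' : (0 : ℝ) < a := by exact_mod_cast (by omega : 0 < a)
      rw [if_pos (by omega), if_neg (by omega)]
      push_cast
      field_simp
      ring
    · rw [if_pos (by omega : 0 ≤ a ∧ 1 ≤ b ∧ a + b ≤ (n : ℤ))]
      rcases ha.eq_or_lt with rfl | ha
      · simp
      · rw [if_pos (by omega)]
        ring
  · rw [if_neg h, if_neg (by omega), if_neg (by omega), add_zero]

/-- The divergence is the outflow to the right and up minus the inflow from the left
and from below. -/
lemma divE_eq_ite_sub_ite (n : ℕ) (a b : ℤ) :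
    divE n (a, b) =
      (if 0 ≤ a ∧ 0 ≤ b ∧ a + b ≤ (n : ℤ) - 1 then 1 / ((a : ℝ) + b + 1) else 0) -
      (if 0 ≤ a ∧ 0 ≤ b ∧ 1 ≤ a + b ∧ a + b ≤ (n : ℤ) then 1 / ((a : ℝ) + b + 1) else 0) := by
  have right_back : Ehalf n (a + 1, b) (a, b) = 0 := by
    simp [Ehalf, show a ≠ a + 1 + 1 by omega]
  have up_back : Ehalf n (a, b + 1) (a, b) = 0 := by
    simp [Ehalf, show b ≠ b + 1 + 1 by omega]
  have left_back : Ehalf n (a, b) (a - 1, b) = 0 := by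
    simp [Ehalf, show a - 1 ≠ a + 1 by omega]
  have down_back : Ehalf n (a, b) (a, b - 1) = 0 := by
    simp [Ehalf, show b - 1 ≠ b + 1 by omega]
  rw [← Ehalf_right_add_up, ← Ehalf_from_left_add_from_below]
  simp only [divE, Eflow, right_back, up_back, left_back, down_back]
  ring

/-- The divergence of the flow `E^n` is `1` at the origin, `-1/(n+1)` at the `n+1`
points `(a,b)`, `a, b ≥ 0`, `a + b = n`, and `0` elsewhere. -/
theorem divergence_of_corner_flow (n : ℕ) (hn : 0 < n) :
    divE n (0, 0) = 1 ∧
    (∀ a b : ℤ, 0 ≤ a → 0 ≤ b → a + b = (n : ℤ) → divE n (a, b) = -(1 / ((n : ℝ) + 1))) ∧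
    (∀ v : ℤ × ℤ, v ≠ (0, 0) → ¬(0 ≤ v.1 ∧ 0 ≤ v.2 ∧ v.1 + v.2 = (n : ℤ)) →
      divE n v = 0) := by
  refine ⟨?_, ?_, ?_⟩
  · rw [divE_eq_ite_sub_ite, if_pos (by omega), if_neg (by omega)]
    simp
  · intro a b ha hb hab
    have hab' : (a : ℝ) + b = n := by exact_mod_cast hab
    rw [divE_eq_ite_sub_ite, if_neg (by omega), if_pos (by omega), hab', zero_sub]
  · rintro ⟨a, b⟩ hv hn'
    have hne : ¬(a = 0 ∧ b = 0) := by simpa using hv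
    have hiff : (0 ≤ a ∧ 0 ≤ b ∧ a + b ≤ (n : ℤ) - 1) ↔
        (0 ≤ a ∧ 0 ≤ b ∧ 1 ≤ a + b ∧ a + b ≤ (n : ℤ)) := by
      dsimp only at hn'
      omega
    simp only [divE_eq_ite_sub_ite, hiff, sub_self]
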